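/- Weyl invariance of the linearized Weyl tensor: for every smooth symmetric field h_{μν} : ℝ^n → ℝ (n ≥ 3) and every smooth function φ : ℝ^n → ℝ, setting h'_{μν} = h_{μν} + 2φη_{μν}, one has 𝒲_{αβγδ}[h'] = 𝒲_{αβγδ}[h] for all indices and all points. -/

import Mathlib

noncomputable section

open MeasureTheory

/-- Minkowski metric `diag(-1,1,…,1)` on `Fin n`. -/
def eta (n : ℕ) (μ ν : Fin n) : ℝ :=
  if μ = ν then (if (μ : ℕ) = 0 then -1 else 1) else 0

/-- Partial derivative in the coordinate direction `μ`. -/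
def pd {n : ℕ} (μ : Fin n) (f : (Fin n → ℝ) → ℝ) : (Fin n → ℝ) → ℝ :=
  fun x => fderiv ℝ f x (Pi.single μ 1)

/-- A rank-2 covariant field on `ℝ^n`. -/
abbrev TensorField (n : ℕ) := Fin n → Fin n → (Fin n → ℝ) → ℝ

/-- Linearized Riemann tensor
`ℛ_{αβγδ}[h] = −(1/2)(∂_α∂_γ h_{βδ} + ∂_β∂_δ h_{αγ} − ∂_α∂_δ h_{βγ} − ∂_β∂_γ h_{αδ})`. -/
def Riem {n : ℕ} (h : TensorField n) (α β γ δ : Fin n) : (Fin n → ℝ) → ℝ :=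
  fun x => -(1/2) * (pd α (pd γ (h β δ)) x + pd β (pd δ (h α γ)) x
    - pd α (pd δ (h β γ)) x - pd β (pd γ (h α δ)) x)

/-- Linearized Ricci tensor
`ℛ_{μν}[h] = (1/2) η^{αλ}(∂_μ∂_α h_{λν} − ∂_λ∂_α h_{μν} − ∂_μ∂_ν h_{λα} + ∂_λ∂_ν h_{μα})`. -/
def Ricci {n : ℕ} (h : TensorField n) (μ ν : Fin n) : (Fin n → ℝ) → ℝ :=
  fun x => (1/2) * ∑ α, ∑ l, eta n α l *
    (pd μ (pd α (h l ν)) x - pd l (pd α (h μ ν)) x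
      - pd μ (pd ν (h l α)) x + pd l (pd ν (h μ α)) x)

/-- Linearized scalar curvature `ℛ[h] = η^{αλ}η^{μν}(∂_λ∂_ν h_{μα} − ∂_α∂_λ h_{μν})`. -/
def Scal {n : ℕ} (h : TensorField n) : (Fin n → ℝ) → ℝ :=
  fun x => ∑ α, ∑ l, ∑ μ, ∑ ν, eta n α l * eta n μ ν *
    (pd l (pd ν (h μ α)) x - pd α (pd l (h μ ν)) x)

/-- Linearized Schouten-type tensor
`𝒦_{μν}[h] = (1/(n−2))(ℛ_{μν}[h] − η_{μν}ℛ[h]/(2(n−1)))`. -/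
def Kt {n : ℕ} (h : TensorField n) (μ ν : Fin n) : (Fin n → ℝ) → ℝ :=
  fun x => (1 / ((n : ℝ) - 2)) *
    (Ricci h μ ν x - eta n μ ν * Scal h x / (2 * ((n : ℝ) - 1)))

/-- Linearized Weyl tensor
`𝒲_{αβγδ}[h] = ℛ_{αβγδ}[h] − η_{αγ}𝒦_{δβ}[h] + η_{αδ}𝒦_{γβ}[h] + η_{βγ}𝒦_{δα}[h] − η_{βδ}𝒦_{γα}[h]`. -/
def Weyl {n : ℕ} (h : TensorField n) (α β γ δ : Fin n) : (Fin n → ℝ) → ℝ :=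
  fun x => Riem h α β γ δ x - eta n α γ * Kt h δ β x + eta n α δ * Kt h γ β x
    + eta n β γ * Kt h δ α x - eta n β δ * Kt h γ α x

/-- Linearized Cotton tensor `𝒞_{αβμ}[h] = ∂_μ𝒦_{βα}[h] − ∂_β𝒦_{μα}[h]`. -/
def Cotton {n : ℕ} (h : TensorField n) (α β μ : Fin n) : (Fin n → ℝ) → ℝ :=
  fun x => pd μ (Kt h β α) x - pd β (Kt h μ α) x

/-- Cotton tensor with all indices raised:
`𝒞^{αβρ}[h] = η^{αα'}η^{ββ'}η^{ρρ'}𝒞_{α'β'ρ'}[h]`. -/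
def CottonUp {n : ℕ} (h : TensorField n) (α β ρ : Fin n) : (Fin n → ℝ) → ℝ :=
  fun x => ∑ α', ∑ β', ∑ ρ', eta n α α' * eta n β β' * eta n ρ ρ' * Cotton h α' β' ρ' x

/-- Linearized Bach tensor `ℬ^{αβ}[h] = −2∂_ρ𝒞^{αβρ}[h]`. -/
def Bach {n : ℕ} (h : TensorField n) (α β : Fin n) : (Fin n → ℝ) → ℝ :=
  fun x => -2 * ∑ ρ, pd ρ (CottonUp h α β ρ) x

open Finset

lemma eta_mul_self {n : ℕ} (α : Fin n) : eta n α α * eta n α α = 1 := by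
  rw [eta, if_pos rfl]
  split_ifs <;> norm_num

lemma eta_comm {n : ℕ} (α β : Fin n) : eta n α β = eta n β α := by
  unfold eta
  by_cases hαβ : α = β
  · subst hαβ
    rfl
  · simp [hαβ, Ne.symm hαβ]

lemma sum_eta_mul {n : ℕ} (α : Fin n) (f : Fin n → ℝ) :
    ∑ l, eta n α l * f l = eta n α α * f α := by
  refine Finset.sum_eq_single α (fun l _ hl => ?_) (fun hα => absurd (mem_univ α) hα)
  simp [eta, hl.symm]

/-- Contracting `η` with `η⁻¹` gives the Kronecker delta. -/
lemma sum_eta_mul_eta_mul {n : ℕ} (μ : Fin n) (f : Fin n → ℝ) :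
    ∑ α, eta n α α * (eta n μ α * f α) = f μ := by
  have hterm : ∀ α, eta n α α * (eta n μ α * f α) = eta n μ α * (eta n α α * f α) :=
    fun α => by ring
  rw [Finset.sum_congr rfl fun α _ => hterm α, sum_eta_mul, ← mul_assoc, eta_mul_self, one_mul]

lemma contDiff_pd {n : ℕ} {f : (Fin n → ℝ) → ℝ} (hf : ContDiff ℝ (⊤ : ℕ∞) f) (μ : Fin n) :
    ContDiff ℝ (⊤ : ℕ∞) (pd μ f) :=
  (hf.fderiv_right (m := (⊤ : ℕ∞)) (by simp)).clm_apply contDiff_const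

lemma pd_add_mul {n : ℕ} {f g : (Fin n → ℝ) → ℝ} (hf : Differentiable ℝ f)
    (hg : Differentiable ℝ g) (c : ℝ) (μ : Fin n) :
    pd μ (fun x => f x + 2 * g x * c) = fun x => pd μ f x + 2 * pd μ g x * c := by
  funext x
  have hd := (hf x).hasFDerivAt.add (((hg x).hasFDerivAt.const_mul 2).mul_const c)
  have he : fderiv ℝ (fun x => f x + 2 * g x * c) x = _ := hd.fderiv
  simp only [pd, he, add_apply, smul_apply, smul_eq_mul]
  ring

lemma pd_pd_add_mul {n : ℕ} {f g : (Fin n → ℝ) → ℝ} (hf : ContDiff ℝ (⊤ : ℕ∞) f)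
    (hg : ContDiff ℝ (⊤ : ℕ∞) g) (c : ℝ) (μ ν : Fin n) (x : Fin n → ℝ) :
    pd μ (pd ν (fun x => f x + 2 * g x * c)) x
      = pd μ (pd ν f) x + 2 * pd μ (pd ν g) x * c := by
  rw [pd_add_mul (hf.differentiable (by simp)) (hg.differentiable (by simp)),
    pd_add_mul ((contDiff_pd hf ν).differentiable (by simp))
      ((contDiff_pd hg ν).differentiable (by simp))]

lemma pd_comm {n : ℕ} {f : (Fin n → ℝ) → ℝ} (hf : ContDiff ℝ (⊤ : ℕ∞) f)
    (μ ν : Fin n) (x : Fin n → ℝ) : pd μ (pd ν f) x = pd ν (pd μ f) x := by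
  have hd : DifferentiableAt ℝ (fderiv ℝ f) x :=
    (hf.fderiv_right (m := (⊤ : ℕ∞)) (by simp)).differentiable (by simp) x
  have key : ∀ ρ σ : Fin n, pd ρ (pd σ f) x
      = fderiv ℝ (fderiv ℝ f) x (Pi.single ρ 1) (Pi.single σ 1) := fun ρ σ => by
    have he := (hd.hasFDerivAt.clm_apply (hasFDerivAt_const (Pi.single σ (1 : ℝ)) x)).fderiv
    change fderiv ℝ (fun y => fderiv ℝ f y (Pi.single σ 1)) x (Pi.single ρ 1) = _
    rw [he]
    simp
  rw [key, key]
  have h2 : ContDiff ℝ 2 f := hf.of_le (WithTop.coe_le_coe.2 (le_top : (2 : ℕ∞) ≤ ⊤))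
  exact (h2.contDiffAt.isSymmSndFDerivAt (by simp)).eq _ _

lemma Ricci_add_conformal {n : ℕ} {h : TensorField n}
    (hsmooth : ∀ μ ν, ContDiff ℝ (⊤ : ℕ∞) (h μ ν))
    {φ : (Fin n → ℝ) → ℝ} (hφ : ContDiff ℝ (⊤ : ℕ∞) φ) (μ ν : Fin n) (x : Fin n → ℝ) :
    Ricci (fun μ ν x => h μ ν x + 2 * φ x * eta n μ ν) μ ν x
      = Ricci h μ ν x + (2 - n) * pd μ (pd ν φ) x
        - eta n μ ν * ∑ α, eta n α α * pd α (pd α φ) x := by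
  simp only [Ricci, pd_pd_add_mul (hsmooth _ _) hφ, sum_eta_mul]
  have h₁ := sum_eta_mul_eta_mul ν fun α => pd μ (pd α φ) x
  have h₂ := sum_eta_mul_eta_mul μ fun α => pd α (pd ν φ) x
  have h₃ : ∑ α : Fin n, pd μ (pd ν φ) x = n * pd μ (pd ν φ) x := by simp
  have hsplit : (2 - n) * pd μ (pd ν φ) x - eta n μ ν * ∑ α, eta n α α * pd α (pd α φ) x
      = ∑ α, (eta n α α * (eta n ν α * pd μ (pd α φ) x)
        + eta n α α * (eta n μ α * pd α (pd ν φ) x) - pd μ (pd ν φ) x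
        - eta n μ ν * (eta n α α * pd α (pd α φ) x)) := by
    rw [sum_sub_distrib, sum_sub_distrib, sum_add_distrib, h₁, h₂, h₃, mul_sum]
    ring
  rw [add_sub_assoc, hsplit, mul_sum, mul_sum, ← sum_add_distrib]
  refine sum_congr rfl fun α _ => ?_
  rw [eta_comm ν α]
  linear_combination (-pd μ (pd ν φ) x) * eta_mul_self α

lemma Scal_add_conformal {n : ℕ} {h : TensorField n}
    (hsmooth : ∀ μ ν, ContDiff ℝ (⊤ : ℕ∞) (h μ ν))
    {φ : (Fin n → ℝ) → ℝ} (hφ : ContDiff ℝ (⊤ : ℕ∞) φ) (x : Fin n → ℝ) :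
    Scal (fun μ ν x => h μ ν x + 2 * φ x * eta n μ ν) x
      = Scal h x - 2 * (n - 1) * ∑ α, eta n α α * pd α (pd α φ) x := by
  simp only [Scal, pd_pd_add_mul (hsmooth _ _) hφ]
  simp only [mul_assoc, ← mul_sum, sum_eta_mul]
  have hinner : ∀ α, ∑ μ, eta n μ μ * (pd α (pd μ (h μ α)) x
        + 2 * (pd α (pd μ φ) x * eta n μ α)
        - (pd α (pd α (h μ μ)) x + 2 * (pd α (pd α φ) x * eta n μ μ)))
      = ∑ μ, eta n μ μ * (pd α (pd μ (h μ α)) x - pd α (pd α (h μ μ)) x)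
        - 2 * ((n - 1) * pd α (pd α φ) x) := fun α => by
    have h₁ := sum_eta_mul_eta_mul α fun μ => pd α (pd μ φ) x
    have h₂ : ∑ μ : Fin n, pd α (pd α φ) x = n * pd α (pd α φ) x := by simp
    have hsplit : 2 * ((n - 1) * pd α (pd α φ) x)
        = ∑ μ, 2 * (pd α (pd α φ) x - eta n μ μ * (eta n α μ * pd α (pd μ φ) x)) := by
      rw [← mul_sum, sum_sub_distrib, h₁, h₂]
      ring
    rw [hsplit, ← sum_sub_distrib]
    refine sum_congr rfl fun μ _ => ?_
    rw [eta_comm α μ]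
    linear_combination (-2 * pd α (pd α φ) x) * eta_mul_self μ
  simp only [hinner]
  rw [← mul_assoc 2, mul_sum _ _ (2 * ((n : ℝ) - 1)), ← sum_sub_distrib]
  refine sum_congr rfl fun α _ => ?_
  ring

lemma Kt_add_conformal {n : ℕ} (hn : 3 ≤ n) {h : TensorField n}
    (hsmooth : ∀ μ ν, ContDiff ℝ (⊤ : ℕ∞) (h μ ν))
    {φ : (Fin n → ℝ) → ℝ} (hφ : ContDiff ℝ (⊤ : ℕ∞) φ) (μ ν : Fin n) (x : Fin n → ℝ) :
    Kt (fun μ ν x => h μ ν x + 2 * φ x * eta n μ ν) μ ν x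
      = Kt h μ ν x - pd μ (pd ν φ) x := by
  have hn' : (3 : ℝ) ≤ n := by exact_mod_cast hn
  have h₁ : (n : ℝ) - 1 ≠ 0 := by linarith
  have h₂ : (n : ℝ) - 2 ≠ 0 := by linarith
  simp only [Kt, Ricci_add_conformal hsmooth hφ, Scal_add_conformal hsmooth hφ]
  field_simp
  ring

/-- Weyl invariance of the linearized Weyl tensor under
`h'_{μν} = h_{μν} + 2φη_{μν}`. -/
theorem weyl_tensor_weyl_invariant {n : ℕ} (hn : 3 ≤ n)
    (h : TensorField n) (hsmooth : ∀ μ ν, ContDiff ℝ (⊤ : ℕ∞) (h μ ν))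
    (hsym : ∀ μ ν, h μ ν = h ν μ)
    (φ : (Fin n → ℝ) → ℝ) (hφ : ContDiff ℝ (⊤ : ℕ∞) φ) :
    ∀ (α β γ δ : Fin n) (x : Fin n → ℝ),
      Weyl (fun μ ν x => h μ ν x + 2 * φ x * eta n μ ν) α β γ δ x
        = Weyl h α β γ δ x := by
  intro α β γ δ x
  simp only [Weyl, Kt_add_conformal hn hsmooth hφ, Riem, pd_pd_add_mul (hsmooth _ _) hφ]
  rw [pd_comm hφ δ β, pd_comm hφ γ β, pd_comm hφ δ α, pd_comm hφ γ α]
  ring
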